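/- arXiv:1011.2997 — 2 statements merged into one kernel-verified Lean document; each statement's English description precedes it below -/
import Mathlib

section
/- An element a of the algebra I₁ has finite-dimensional image as a K-linear operator on K[x] if and only if a belongs to F. Equivalently, F equals the intersection of I₁ with the set of finite-rank (compact) K-linear operators on K[x]. -/
open Polynomial

noncomputable section
set_option synthInstance.maxHeartbeats 1000000
set_option maxHeartbeats 1000000
set_option linter.unusedSectionVars false

variable (K : Type*) [Field K] [CharZero K]

/-- The derivative operator `∂ = d/dx` on `K[x]`. -/
def derOp : Module.End K (Polynomial K) := Polynomial.derivative

/-- The multiplication-by-`x` operator on `K[x]`. -/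
def xOp : Module.End K (Polynomial K) := LinearMap.mulLeft K Polynomial.X

/-- The integration operator `∫`, determined by `∫ xⁿ = xⁿ⁺¹/(n+1)`. -/
def intOp : Module.End K (Polynomial K) :=
  (Polynomial.basisMonomials K).constr K fun n => ((n : K) + 1)⁻¹ • X ^ (n + 1)

/-- The algebra `I₁` of polynomial integro-differential operators: the subalgebra of
`End_K(K[x])` generated by `x`, `∂` and `∫`. -/
def I1 : Subalgebra K (Module.End K (Polynomial K)) :=
  Algebra.adjoin K {xOp K, derOp K, intOp K}

/-- `e_{ij} := ∫^i ∂^j − ∫^{i+1} ∂^{j+1}`. -/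
def eOp (i j : ℕ) : Module.End K (Polynomial K) :=
  intOp K ^ i * derOp K ^ j - intOp K ^ (i + 1) * derOp K ^ (j + 1)

/-- `F`, the `K`-linear span of the `e_{ij}`; it is the (two-sided) ideal of compact
operators of `I₁`. -/
def Fset : Submodule K (Module.End K (Polynomial K)) :=
  Submodule.span K {f | ∃ i j, f = eOp K i j}

lemma xOp_mem : xOp K ∈ I1 K := Algebra.subset_adjoin (by simp)
lemma derOp_mem : derOp K ∈ I1 K := Algebra.subset_adjoin (by simp)
lemma intOp_mem : intOp K ∈ I1 K := Algebra.subset_adjoin (by simp)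

lemma eOp_mem (i j : ℕ) : eOp K i j ∈ I1 K :=
  sub_mem (mul_mem (pow_mem (intOp_mem K) i) (pow_mem (derOp_mem K) j))
    (mul_mem (pow_mem (intOp_mem K) (i + 1)) (pow_mem (derOp_mem K) (j + 1)))

/-- `e_{ij}` as an element of the ring `I₁`. -/
def eI (i j : ℕ) : I1 K := ⟨eOp K i j, eOp_mem K i j⟩

/-- `∂` as an element of the ring `I₁`. -/
def derI : I1 K := ⟨derOp K, derOp_mem K⟩

/-- `∫` as an element of the ring `I₁`. -/
def intI : I1 K := ⟨intOp K, intOp_mem K⟩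

/-- `H := ∂ ∘ x` (first multiply by `x`, then differentiate). -/
def hOp : Module.End K (Polynomial K) := derOp K * xOp K

/-- `K[H]`, the unital subalgebra of `I₁` generated by `H`. -/
def KH : Subalgebra K (Module.End K (Polynomial K)) := Algebra.adjoin K {hOp K}

/-- The action of `a ∈ I₁` on a left `I₁`-module `M`, as a `K`-linear map `a_M : M → M`. -/
def actMap (a : I1 K) (M : Type*) [AddCommGroup M] [Module (I1 K) M] [Module K M]
    [SMulCommClass K (I1 K) M] : M →ₗ[K] M where
  toFun m := a • m
  map_add' := smul_add a
  map_smul' k m := (smul_comm k a m).symm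

/-- Right multiplication `b ↦ b * a` in a ring `R`, as a homomorphism of left `R`-modules. -/
def rmulMap (R : Type*) [Ring R] (a : R) : R →ₗ[R] R where
  toFun b := b * a
  map_add' b c := add_mul b c a
  map_smul' c b := by simp [smul_eq_mul, mul_assoc]

/-- Left multiplication `b ↦ a * b` in a ring `R`, as a homomorphism of right `R`-modules
(i.e. of left `Rᵐᵒᵖ`-modules). -/
def lmulMap (R : Type*) [Ring R] (a : R) : R →ₗ[Rᵐᵒᵖ] R where
  toFun b := a * b
  map_add' b c := mul_add a b c
  map_smul' c b := by simp [MulOpposite.smul_eq_mul_unop, mul_assoc]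

/-- The centralizer `Cen_{I₁}(a) = {b ∈ I₁ : ab = ba}` of `a` in `I₁`, as a subalgebra of
`End_K(K[x])`. -/
def Cen (a : Module.End K (Polynomial K)) : Subalgebra K (Module.End K (Polynomial K)) :=
  I1 K ⊓ Subalgebra.centralizer K {a}

/-- `Cen_F(a) = {f ∈ F : af = fa}`, a `K`-subspace of `End_K(K[x])`. -/
def CenF (a : Module.End K (Polynomial K)) : Submodule K (Module.End K (Polynomial K)) :=
  Fset K ⊓ Subalgebra.toSubmodule (Subalgebra.centralizer K {a})


lemma intOp_monomial (n : ℕ) (c : K) :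
    intOp K (monomial n c) = monomial (n + 1) (c * ((n : K) + 1)⁻¹) := by
  have h : monomial n c = c • Polynomial.basisMonomials K n := by
    simp [smul_monomial]
  rw [h, map_smul, intOp, Module.Basis.constr_basis, smul_smul, X_pow_eq_monomial, smul_monomial,
    smul_eq_mul, mul_one]

lemma coeff_succ_intOp (f : K[X]) (n : ℕ) :
    (intOp K f).coeff (n + 1) = f.coeff n * ((n : K) + 1)⁻¹ := by
  induction f using Polynomial.induction_on' with
  | add p q hp hq => simp [hp, hq, add_mul]
  | monomial m c =>
    rw [intOp_monomial, coeff_monomial, coeff_monomial]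
    by_cases h : m = n <;> simp [h]

lemma coeff_zero_intOp (f : K[X]) : (intOp K f).coeff 0 = 0 := by
  induction f using Polynomial.induction_on' with
  | add p q hp hq => simp [hp, hq]
  | monomial m c => simp [intOp_monomial, coeff_monomial]

lemma sub_intOp_derOp (f : K[X]) : f - intOp K (derOp K f) = C (f.coeff 0) := by
  ext n
  cases n with
  | zero => simp [coeff_zero_intOp]
  | succ n =>
    have : (n : K) + 1 ≠ 0 := Nat.cast_add_one_ne_zero n
    simp [coeff_succ_intOp, derOp, coeff_derivative, this]

lemma intOp_pow_C (i : ℕ) (c : K) :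
    (intOp K ^ i) (C c) = monomial i (c * (i.factorial : K)⁻¹) := by
  induction i with
  | zero => simp
  | succ i ih =>
    rw [pow_succ', Module.End.mul_apply, ih, intOp_monomial, Nat.factorial_succ]
    push_cast
    rw [mul_inv_rev, mul_assoc]

lemma coeff_zero_derOp_pow (j : ℕ) (f : K[X]) :
    ((derOp K ^ j) f).coeff 0 = (j.factorial : K) * f.coeff j := by
  rw [derOp, Module.End.pow_apply, coeff_iterate_derivative]
  simp [Nat.descFactorial_self]

lemma eOp_apply (i j : ℕ) (f : K[X]) :
    eOp K i j f = monomial i ((j.factorial : K) * f.coeff j * (i.factorial : K)⁻¹) := by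
  have h : eOp K i j f =
      (intOp K ^ i) ((derOp K ^ j) f - intOp K (derOp K ((derOp K ^ j) f))) := by
    simp only [eOp, LinearMap.sub_apply, Module.End.mul_apply, map_sub, pow_succ (intOp K),
      pow_succ' (derOp K)]
  rw [h, sub_intOp_derOp, intOp_pow_C, coeff_zero_derOp_pow]

/-- The rank-one operators `f ↦ (coefficient of xʲ in f) • g` belong to `F`. -/
lemma smulRight_lcoeff_mem_Fset (j : ℕ) (g : K[X]) :
    (lcoeff K j).smulRight g ∈ Fset K := by
  induction g using Polynomial.induction_on' with
  | add p q hp hq =>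
    have h : (lcoeff K j).smulRight (p + q) =
        (lcoeff K j).smulRight p + (lcoeff K j).smulRight q :=
      LinearMap.ext fun f => smul_add _ p q
    rw [h]
    exact add_mem hp hq
  | monomial i c =>
    have h : (lcoeff K j).smulRight (monomial i c) =
        (c * (i.factorial : K) * (j.factorial : K)⁻¹) • eOp K i j := by
      refine LinearMap.ext fun f => ?_
      have hi : (i.factorial : K) ≠ 0 := Nat.cast_ne_zero.2 i.factorial_ne_zero
      have hj : (j.factorial : K) ≠ 0 := Nat.cast_ne_zero.2 j.factorial_ne_zero
      simp only [LinearMap.smulRight_apply, lcoeff_apply, LinearMap.smul_apply, eOp_apply,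
        smul_monomial, smul_eq_mul]
      congr 1
      field_simp
    rw [h]
    exact Submodule.smul_mem _ _ (Submodule.subset_span ⟨i, j, rfl⟩)

lemma mem_Fset_of_forall_X_pow (a : Module.End K K[X]) (N : ℕ)
    (h : ∀ n, N ≤ n → a (X ^ n) = 0) : a ∈ Fset K := by
  have ha : a = ∑ j ∈ Finset.range N, (lcoeff K j).smulRight (a (X ^ j)) := by
    refine (Polynomial.basisMonomials K).ext fun n => ?_
    simp only [coe_basisMonomials, LinearMap.sum_apply, LinearMap.smulRight_apply, lcoeff_apply,
      ← X_pow_eq_monomial, coeff_X_pow, ite_smul, one_smul, zero_smul, Finset.sum_ite_eq',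
      Finset.mem_range]
    split_ifs with hn
    · rfl
    · exact h n (not_lt.1 hn)
  rw [ha]
  exact sum_mem fun j _ => smulRight_lcoeff_mem_Fset K j _

/-- Every `a ∈ I₁` lowers the order of vanishing at `0` by at most a constant. -/
lemma exists_X_pow_dvd_of_mem_I1 {a : Module.End K K[X]} (ha : a ∈ I1 K) :
    ∃ D, ∀ n f, X ^ (n + D) ∣ f → X ^ n ∣ a f := by
  induction ha using Algebra.adjoin_induction with
  | mem a ha =>
    refine ⟨1, fun n f hf => ?_⟩
    rw [X_pow_dvd_iff] at hf ⊢
    intro d hd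
    rcases ha with rfl | rfl | rfl
    · cases d with
      | zero => simp [xOp]
      | succ d => simp [xOp, hf d (by omega)]
    · simp [derOp, coeff_derivative, hf (d + 1) (by omega)]
    · cases d with
      | zero => exact coeff_zero_intOp K f
      | succ d => rw [coeff_succ_intOp, hf d (by omega), zero_mul]
  | algebraMap r =>
    refine ⟨0, fun n f hf => ?_⟩
    rw [Module.algebraMap_end_apply]
    exact dvd_smul_of_dvd r hf
  | add a b _ _ iha ihb =>
    obtain ⟨D, hD⟩ := iha
    obtain ⟨E, hE⟩ := ihb
    exact ⟨D + E, fun n f hf => dvd_add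
      (hD n f ((pow_dvd_pow X (by omega)).trans hf))
      (hE n f ((pow_dvd_pow X (by omega)).trans hf))⟩
  | mul a b _ _ iha ihb =>
    obtain ⟨D, hD⟩ := iha
    obtain ⟨E, hE⟩ := ihb
    exact ⟨D + E, fun n f hf => hD n _ (hE (n + D) f (by rwa [add_assoc]))⟩

lemma exists_le_degreeLT (V : Submodule K K[X]) [FiniteDimensional K V] :
    ∃ M, V ≤ degreeLT K M := by
  obtain ⟨s, rfl⟩ := (Submodule.fg_iff_finiteDimensional V).2 ‹_›
  refine ⟨s.sup natDegree + 1, Submodule.span_le.2 fun p hp => mem_degreeLT.2 ?_⟩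
  exact degree_le_natDegree.trans_lt
    (Nat.cast_lt.2 (Nat.lt_succ_of_le (Finset.le_sup (f := natDegree) hp)))

lemma finiteDimensional_range_of_mem_Fset {a : Module.End K K[X]} (ha : a ∈ Fset K) :
    FiniteDimensional K (LinearMap.range a) := by
  induction ha using Submodule.span_induction with
  | mem a ha =>
    obtain ⟨i, j, rfl⟩ := ha
    refine Submodule.finiteDimensional_of_le (S₂ := K ∙ (X ^ i : K[X])) ?_
    rintro _ ⟨f, rfl⟩
    rw [eOp_apply, ← mul_one (_ * _), ← smul_eq_mul, ← smul_monomial, ← X_pow_eq_monomial]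
    exact Submodule.smul_mem _ _ (Submodule.mem_span_singleton_self _)
  | zero => rw [LinearMap.range_zero]; infer_instance
  | add a b _ _ iha ihb => exact Submodule.finiteDimensional_of_le (LinearMap.range_add_le a b)
  | smul c a _ ih =>
    refine Submodule.finiteDimensional_of_le (S₂ := LinearMap.range a) ?_
    rintro _ ⟨f, rfl⟩
    exact Submodule.smul_mem _ c (LinearMap.mem_range_self a f)

/-- An element `a ∈ I₁` has finite-dimensional image as a `K`-linear operator on
`K[x]` if and only if `a ∈ F`. -/
theorem statement0 (a : Module.End K (Polynomial K)) (ha : a ∈ I1 K) :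
    FiniteDimensional K (LinearMap.range a) ↔ a ∈ Fset K := by
  refine ⟨fun h => ?_, finiteDimensional_range_of_mem_Fset K⟩
  obtain ⟨M, hM⟩ := exists_le_degreeLT K (LinearMap.range a)
  obtain ⟨D, hD⟩ := exists_X_pow_dvd_of_mem_I1 K ha
  refine mem_Fset_of_forall_X_pow K a (M + D) fun n hn => ?_
  refine eq_zero_of_dvd_of_degree_lt (hD M _ (pow_dvd_pow X hn)) ?_
  rw [degree_X_pow]
  exact mem_degreeLT.1 (hM (LinearMap.mem_range_self a _))

end
end

section
/- Every simple left I₁-module M satisfies exactly one of the following: either F·M = 0, or M is isomorphic as an I₁-module to K[x] equipped with its natural action of I₁ ⊆ End_K(K[x]). -/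
open Polynomial

noncomputable section
set_option synthInstance.maxHeartbeats 1000000
set_option maxHeartbeats 1000000
set_option linter.unusedSectionVars false

variable (K : Type*) [Field K] [CharZero K]

/-- The cokernel `R ⧸ Im f` of a homomorphism of left `R`-modules `f : R → R`. -/
abbrev Coker (R : Type*) [Ring R] (f : R →ₗ[R] R) : Type _ := R ⧸ LinearMap.range f

/-- The cokernel `R ⧸ Im f` of a homomorphism of right `R`-modules `f : R → R`. -/
abbrev CokerOp (R : Type*) [Ring R] (f : R →ₗ[Rᵐᵒᵖ] R) : Type _ := R ⧸ LinearMap.range f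

lemma intOp_derOp_apply (p : K[X]) : intOp K (derOp K p) = p - C (p.coeff 0) := by
  induction p using Polynomial.induction_on' with
  | add p q hp hq => simp only [map_add, hp, hq, coeff_add]; ring
  | monomial n a =>
    cases n with
    | zero => simp [derOp]
    | succ n =>
      have h : (monomial n (a * ((n : K) + 1)) : K[X])
          = (a * ((n : K) + 1)) • basisMonomials K n := by
        simp [smul_monomial]
      have hn : (n : K) + 1 ≠ 0 := Nat.cast_add_one_ne_zero n
      simp only [derOp, derivative_monomial, Nat.add_sub_cancel, Nat.cast_add, Nat.cast_one]
      rw [h, intOp, map_smul, Module.Basis.constr_basis, smul_smul, mul_assoc,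
        mul_inv_cancel₀ hn, mul_one]
      simp [coeff_monomial, smul_X_eq_monomial]

lemma eOp_zero_zero_apply (p : K[X]) : eOp K 0 0 p = C (p.coeff 0) := by
  simp [eOp, intOp_derOp_apply]

lemma eI_eq (i j : ℕ) : eI K i j = intI K ^ i * eI K 0 0 * derI K ^ j := by
  apply Subtype.ext
  simp [eI, intI, derI, eOp, pow_succ, pow_succ' (derOp K), mul_sub, sub_mul, mul_assoc]

lemma eI_zero_zero_mul_self : eI K 0 0 * eI K 0 0 = eI K 0 0 := by
  apply Subtype.ext
  apply LinearMap.ext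
  intro p
  simp [eI, eOp_zero_zero_apply]

lemma I1_smul_def (a : I1 K) (p : K[X]) : a • p = (a : Module.End K K[X]) p := rfl

/-- An operator in `I₁` is determined on the image of `e₀₀` by its value at `1`. -/
lemma mul_eI_zero_zero_eq {a b : I1 K} (h : a • (1 : K[X]) = b • (1 : K[X])) :
    a * eI K 0 0 = b * eI K 0 0 := by
  apply Subtype.ext
  apply LinearMap.ext
  intro p
  have hC : C (p.coeff 0) = p.coeff 0 • (1 : K[X]) := by rw [smul_eq_C_mul, mul_one]
  simpa [eI, eOp_zero_zero_apply, hC, I1_smul_def] using congrArg (p.coeff 0 • ·) h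

lemma eI_zero_smul (j : ℕ) (p : K[X]) : eI K 0 j • p = C ((j.factorial : K) * p.coeff j) := by
  rw [eI_eq, I1_smul_def]
  have h : (derOp K ^ j) p = derivative^[j] p := Module.End.pow_apply _ _ _
  simp [eI, derI, eOp_zero_zero_apply, h, coeff_iterate_derivative, Nat.descFactorial_self]

lemma exists_I1_smul_one_eq (p : K[X]) : ∃ a : I1 K, a • (1 : K[X]) = p := by
  refine ⟨⟨aeval (xOp K) p, Algebra.adjoin_mono (by simp)
    (aeval_mem_adjoin_singleton K (xOp K))⟩, ?_⟩
  have h : aeval (xOp K) p = Algebra.lmul K K[X] (aeval X p) :=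
    aeval_algHom_apply (Algebra.lmul K K[X]) X p
  simp [I1_smul_def, h]

/-- A nonzero vector fixed by `e₀₀` has the same annihilator in `I₁` as `1 ∈ K[x]`. -/
lemma smul_eq_zero_iff_smul_one_eq_zero {M : Type*} [AddCommGroup M] [Module (I1 K) M] {n : M}
    (hn : n ≠ 0) (hfix : eI K 0 0 • n = n) (a : I1 K) :
    a • n = 0 ↔ a • (1 : K[X]) = 0 := by
  have key {b c : I1 K} (h : b • (1 : K[X]) = c • (1 : K[X])) : b • n = c • n := by
    rw [← hfix, smul_smul, smul_smul, mul_eI_zero_zero_eq K h]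
  refine ⟨fun ha => ?_, fun ha => by simpa using key (c := 0) (by simpa using ha)⟩
  by_contra hp
  set p : K[X] := a • (1 : K[X]) with hpdef
  set c : K := (p.natDegree.factorial : K) * p.leadingCoeff
  have hc : c ≠ 0 := mul_ne_zero (Nat.cast_ne_zero.mpr (Nat.factorial_ne_zero _))
    (leadingCoeff_ne_zero.mpr hp)
  have h1 : (eI K 0 p.natDegree * a) • n = algebraMap K (I1 K) c • n := by
    apply key
    rw [mul_smul, ← hpdef, eI_zero_smul, I1_smul_def]
    simp [c, Algebra.algebraMap_eq_smul_one, smul_eq_C_mul]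
  rw [mul_smul, ha, smul_zero] at h1
  apply hn
  have h2 := congrArg (algebraMap K (I1 K) c⁻¹ • ·) h1.symm
  simpa [smul_smul, ← map_mul, inv_mul_cancel₀ hc] using h2

lemma smul_eq_zero_of_mem_Fset {M : Type*} [AddCommGroup M] [Module (I1 K) M] {m : M}
    (h : ∀ i j, eI K i j • m = 0) {f : I1 K} (hf : (f : Module.End K K[X]) ∈ Fset K) :
    f • m = 0 := by
  suffices H : ∀ g ∈ Fset K, ∃ hg : g ∈ I1 K, (⟨g, hg⟩ : I1 K) • m = 0 from (H f hf).2
  intro g hg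
  induction hg using Submodule.span_induction with
  | mem g hg =>
    obtain ⟨i, j, rfl⟩ := hg
    exact ⟨eOp_mem K i j, h i j⟩
  | zero => exact ⟨zero_mem _, zero_smul (I1 K) m⟩
  | add g g' _ _ hg hg' =>
    obtain ⟨hg, hm⟩ := hg
    obtain ⟨hg', hm'⟩ := hg'
    exact ⟨add_mem hg hg',
      (add_smul (⟨g, hg⟩ : I1 K) ⟨g', hg'⟩ m).trans (by rw [hm, hm', add_zero])⟩
  | smul k g _ hg =>
    obtain ⟨hg, hm⟩ := hg
    refine ⟨Subalgebra.smul_mem _ hg k, ?_⟩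
    have : (⟨k • g, Subalgebra.smul_mem _ hg k⟩ : I1 K)
        = algebraMap K (I1 K) k * ⟨g, hg⟩ := (Algebra.smul_def k (⟨g, hg⟩ : I1 K))
    rw [this, mul_smul, hm, smul_zero]

lemma nonempty_linearEquiv_of_ker_eq {R A M N : Type*} [Ring R] [AddCommGroup A] [Module R A]
    [AddCommGroup M] [Module R M] [AddCommGroup N] [Module R N] {f : A →ₗ[R] M} {g : A →ₗ[R] N}
    (hf : Function.Surjective f) (hg : Function.Surjective g)
    (h : LinearMap.ker f = LinearMap.ker g) : Nonempty (M ≃ₗ[R] N) :=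
  ⟨((f.quotKerEquivOfSurjective hf).symm.trans (Submodule.quotEquivOfEq _ _ h)).trans
    (g.quotKerEquivOfSurjective hg)⟩

/-- A simple module with a nonzero vector fixed by `e₀₀` is isomorphic to `K[x]`. -/
lemma nonempty_linearEquiv_of_eI_smul_eq {M : Type*} [AddCommGroup M] [Module (I1 K) M]
    [IsSimpleModule (I1 K) M] {n : M} (hn : n ≠ 0) (hfix : eI K 0 0 • n = n) :
    Nonempty (M ≃ₗ[I1 K] K[X]) := by
  have hker : LinearMap.ker (LinearMap.toSpanSingleton (I1 K) M n)
      = LinearMap.ker (LinearMap.toSpanSingleton (I1 K) K[X] 1) := by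
    ext a
    simpa using smul_eq_zero_iff_smul_one_eq_zero K hn hfix a
  have hsurj : Function.Surjective (LinearMap.toSpanSingleton (I1 K) K[X] 1) :=
    exists_I1_smul_one_eq K
  exact nonempty_linearEquiv_of_ker_eq (R := I1 K) (A := I1 K)
    (IsSimpleModule.toSpanSingleton_surjective (I1 K) hn) hsurj hker

/-- each simple left `I₁`-module `M` satisfies exactly one of: `F·M = 0`, or
`M ≅ K[x]` as `I₁`-modules (where `K[x]` carries its natural `I₁ ⊆ End_K(K[x])` action). -/
theorem statement2 (M : Type*) [AddCommGroup M] [Module (I1 K) M]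
    (hM : IsSimpleModule (I1 K) M) :
    Xor' (∀ f : I1 K, (f : Module.End K (Polynomial K)) ∈ Fset K → ∀ m : M, f • m = 0)
      (Nonempty (M ≃ₗ[I1 K] Polynomial K)) := by
  by_cases hF : ∀ f : I1 K, (f : Module.End K (Polynomial K)) ∈ Fset K → ∀ m : M, f • m = 0
  · refine Or.inl ⟨hF, fun ⟨φ⟩ => ?_⟩
    have h := congrArg φ (hF (eI K 0 0) (Submodule.subset_span ⟨0, 0, rfl⟩) (φ.symm 1))
    simp [eI_zero_smul] at h
  · refine Or.inr ⟨?_, hF⟩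
    push Not at hF
    obtain ⟨f, hf, m, hm⟩ := hF
    obtain ⟨i, j, hij⟩ : ∃ i j, eI K i j • m ≠ 0 := by
      by_contra! h
      exact hm (smul_eq_zero_of_mem_Fset K h hf)
    refine nonempty_linearEquiv_of_eI_smul_eq K (n := (eI K 0 0 * derI K ^ j) • m) ?_ ?_
    · intro h0
      apply hij
      rw [eI_eq, mul_assoc, mul_smul, h0, smul_zero]
    · rw [smul_smul, ← mul_assoc, eI_zero_zero_mul_self]

end
end
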